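/- Soundness of Axiom 3 (Pattern Augmentation): suppose the pattern Q' is embeddable in the pattern Q via an injective embedding f, and let X, Y be literal sets over the pattern nodes of Q'. Then (Q', Δ, X → Y) implies (Q, Δ, f(X) → f(Y)): every temporal graph 𝒢_T that satisfies the TGFD (Q', Δ, X → Y) also satisfies the TGFD (Q, Δ, f(X) → f(Y)). -/

import Mathlib

/-- A graph pattern: a directed graph with pattern nodes `VQ`,
edge set, and node and edge labels. -/
structure GraphPattern (VQ NL EL : Type) where
  edges : Set (VQ × VQ)
  nodeLabel : VQ → NL
  edgeLabel : VQ × VQ → EL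

/-- A temporal graph over a fixed node set `V`: for each timestamp,
an edge set, node and edge labels, and attribute values. -/
structure TemporalGraph (V NL EL Attr Val : Type) where
  edges : ℤ → Set (V × V)
  nodeLabel : ℤ → V → NL
  edgeLabel : ℤ → V × V → EL
  attr : ℤ → V → Attr → Val

/-- A match of pattern `Q` in the snapshot of `G` at time `t`: an injective map
preserving node labels and mapping each pattern edge to an edge of the snapshot
with the same label. -/
def IsMatch {V VQ NL EL Attr Val : Type} (G : TemporalGraph V NL EL Attr Val)
    (Q : GraphPattern VQ NL EL) (t : ℤ) (h : VQ → V) : Prop :=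
  Function.Injective h ∧
  (∀ u : VQ, G.nodeLabel t (h u) = Q.nodeLabel u) ∧
  ∀ e ∈ Q.edges, (h e.1, h e.2) ∈ G.edges t ∧
    G.edgeLabel t (h e.1, h e.2) = Q.edgeLabel e

/-- A literal over pattern nodes: constant literal `u.A = c` or
variable literal `u.A = u'.A'`. -/
inductive Literal (VQ Attr Val : Type) where
  | const (u : VQ) (A : Attr) (c : Val)
  | varl (u : VQ) (A : Attr) (u' : VQ) (A' : Attr)

/-- A pair of matches `(hi, hj)` at times `(i, j)` satisfies a literal. -/
def SatLit {V VQ NL EL Attr Val : Type} (G : TemporalGraph V NL EL Attr Val)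
    (i j : ℤ) (hi hj : VQ → V) : Literal VQ Attr Val → Prop
  | .const u A c => G.attr i (hi u) A = c ∧ G.attr j (hj u) A = c
  | .varl u A u' A' => G.attr i (hi u) A = G.attr j (hj u') A'

/-- A pair of matches satisfies a set of literals. -/
def SatLits {V VQ NL EL Attr Val : Type} (G : TemporalGraph V NL EL Attr Val)
    (i j : ℤ) (hi hj : VQ → V) (Z : Set (Literal VQ Attr Val)) : Prop :=
  ∀ l ∈ Z, SatLit G i j hi hj l

/-- A TGFD `(Q, (p, q), X → Y)` with `0 ≤ p ≤ q`. -/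
structure TGFD (VQ NL EL Attr Val : Type) where
  Q : GraphPattern VQ NL EL
  p : ℤ
  q : ℤ
  hp : 0 ≤ p
  hpq : p ≤ q
  X : Set (Literal VQ Attr Val)
  Y : Set (Literal VQ Attr Val)

/-- A pair of matches of `σ.Q` at times `i, j` matches the TGFD `σ`:
both are matches of `σ.Q`, `|j - i| ∈ [p, q]`, and the pair satisfies `X`. -/
def MatchesTGFD {V VQ NL EL Attr Val : Type} (G : TemporalGraph V NL EL Attr Val)
    (σ : TGFD VQ NL EL Attr Val) (i j : ℤ) (hi hj : VQ → V) : Prop :=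
  IsMatch G σ.Q i hi ∧ IsMatch G σ.Q j hj ∧
  σ.p ≤ |j - i| ∧ |j - i| ≤ σ.q ∧ SatLits G i j hi hj σ.X

/-- `G ⊨ σ`: every pair of matches that matches `σ` also satisfies `Y`. -/
def Satisfies {V VQ NL EL Attr Val : Type} (G : TemporalGraph V NL EL Attr Val)
    (σ : TGFD VQ NL EL Attr Val) : Prop :=
  ∀ (i j : ℤ) (hi hj : VQ → V),
    MatchesTGFD G σ i j hi hj → SatLits G i j hi hj σ.Y

/-- `Q'` is embeddable in `Q` via `f`: `f` is injective, preserves node labels,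
and maps every edge of `Q'` to an edge of `Q` with the same label. -/
def IsEmbedding {VQ' VQ NL EL : Type} (Q' : GraphPattern VQ' NL EL)
    (Q : GraphPattern VQ NL EL) (f : VQ' → VQ) : Prop :=
  Function.Injective f ∧
  (∀ u : VQ', Q.nodeLabel (f u) = Q'.nodeLabel u) ∧
  ∀ e ∈ Q'.edges, (f e.1, f e.2) ∈ Q.edges ∧
    Q.edgeLabel (f e.1, f e.2) = Q'.edgeLabel e

/-- Transport of a literal along a map of pattern nodes. -/
def Literal.map {VQ' VQ Attr Val : Type} (f : VQ' → VQ) :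
    Literal VQ' Attr Val → Literal VQ Attr Val
  | .const u A c => .const (f u) A c
  | .varl u A u' A' => .varl (f u) A (f u') A'

theorem IsMatch.comp_embedding {V VQ' VQ NL EL Attr Val : Type}
    {G : TemporalGraph V NL EL Attr Val} {Q' : GraphPattern VQ' NL EL}
    {Q : GraphPattern VQ NL EL} {f : VQ' → VQ} {t : ℤ} {m : VQ → V}
    (hm : IsMatch G Q t m) (hf : IsEmbedding Q' Q f) : IsMatch G Q' t (m ∘ f) := by
  obtain ⟨m_inj, m_node, m_edge⟩ := hm
  obtain ⟨f_inj, f_node, f_edge⟩ := hf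
  refine ⟨m_inj.comp f_inj, fun u => (m_node (f u)).trans (f_node u), fun e he => ?_⟩
  obtain ⟨he_mem, he_label⟩ := f_edge e he
  obtain ⟨hm_mem, hm_label⟩ := m_edge _ he_mem
  exact ⟨hm_mem, hm_label.trans he_label⟩

theorem satLit_map_iff {V VQ' VQ NL EL Attr Val : Type}
    (G : TemporalGraph V NL EL Attr Val) (f : VQ' → VQ) (i j : ℤ) (hi hj : VQ → V)
    (l : Literal VQ' Attr Val) :
    SatLit G i j hi hj (l.map f) ↔ SatLit G i j (hi ∘ f) (hj ∘ f) l := by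
  cases l <;> rfl

theorem satLits_image_map_iff {V VQ' VQ NL EL Attr Val : Type}
    (G : TemporalGraph V NL EL Attr Val) (f : VQ' → VQ) (i j : ℤ) (hi hj : VQ → V)
    (Z : Set (Literal VQ' Attr Val)) :
    SatLits G i j hi hj (Literal.map f '' Z) ↔ SatLits G i j (hi ∘ f) (hj ∘ f) Z := by
  simp only [SatLits, Set.forall_mem_image, satLit_map_iff]

/-- Soundness of Axiom 3 (Pattern Augmentation). -/
theorem pattern_augmentation_sound {V VQ' VQ NL EL Attr Val : Type}
    (G : TemporalGraph V NL EL Attr Val)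
    (Q' : GraphPattern VQ' NL EL) (Q : GraphPattern VQ NL EL)
    (f : VQ' → VQ) (hf : IsEmbedding Q' Q f)
    (p q : ℤ) (hp : 0 ≤ p) (hpq : p ≤ q)
    (X Y : Set (Literal VQ' Attr Val))
    (h : Satisfies G ⟨Q', p, q, hp, hpq, X, Y⟩) :
    Satisfies G ⟨Q, p, q, hp, hpq, Literal.map f '' X, Literal.map f '' Y⟩ := by
  rintro i j hi hj ⟨match_i, match_j, hp_le, hle_q, hX⟩
  exact (satLits_image_map_iff G f i j hi hj Y).2 <|
    h i j (hi ∘ f) (hj ∘ f) ⟨match_i.comp_embedding hf, match_j.comp_embedding hf, hp_le, hle_q,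
      (satLits_image_map_iff G f i j hi hj X).1 hX⟩
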